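/- Let u,v ∈ ℝ⁴, let s0 > 0, and let (α0,β0) with α0 > 0 be such that f_{u,v,s0}(α0,β0) = 0, ∂f_{u,v,s0}/∂α (α0,β0) = 0, ∂f_{u,v,s0}/∂β (α0,β0) = 0, and Δ_{21}(u,v)(α0,β0) ≠ 0. Then s0 < 1/3 and Δ_{02}(u,v)(α0,β0) ≠ 0; indeed these data force the identity α0²(s0 − 1/3)·Δ_{02}(u,v)(α0,β0)² = −(2s0 + 1/3)·Δ_{12}(u,v)(α0,β0)². In other words, a critical point of a numerical λ-wall lying off the associated numerical ν-wall can only occur for s < 1/3. -/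

import Mathlib

noncomputable section

/-- `ρ_v(α,β) = v2 − βv1 + (β²−α²)v0/2`. -/
def rho (v : Fin 4 → ℝ) (α β : ℝ) : ℝ :=
  v 2 - β * v 1 + (β ^ 2 - α ^ 2) * v 0 / 2

/-- `τ_{v,s}(α,β)`. -/
def tau (v : Fin 4 → ℝ) (s α β : ℝ) : ℝ :=
  v 3 - β * v 2 + β ^ 2 / 2 * v 1 - β ^ 3 / 6 * v 0 - (s + 1 / 6) * (v 1 - β * v 0) * α ^ 2

/-- `f_{u,v,s}(α,β) = τ_{u,s}ρ_v − τ_{v,s}ρ_u`. -/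
def fwall (u v : Fin 4 → ℝ) (s α β : ℝ) : ℝ :=
  tau u s α β * rho v α β - tau v s α β * rho u α β

/-- The twisted Chern character `ch^{α,β}(v)` (with `ch₃^{α,β} = τ_{v,1/3}`). -/
def chab (v : Fin 4 → ℝ) (α β : ℝ) : Fin 4 → ℝ :=
  ![v 0, v 1 - β * v 0, rho v α β, tau v (1 / 3) α β]

/-- `Δ_{ij}(u,v)(α,β) = ch_i^{α,β}(u)ch_j^{α,β}(v) − ch_j^{α,β}(u)ch_i^{α,β}(v)`. -/
def Dlt (u v : Fin 4 → ℝ) (α β : ℝ) (i j : Fin 4) : ℝ :=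
  chab u α β i * chab v α β j - chab u α β j * chab v α β i

theorem hasDerivAt_rho_alpha (v : Fin 4 → ℝ) (α β : ℝ) :
    HasDerivAt (fun a : ℝ => rho v a β) (-(α * v 0)) α := by
  unfold rho
  have h := ((((hasDerivAt_pow 2 α).const_sub (β ^ 2)).mul_const (v 0)).div_const 2).const_add
    (v 2 - β * v 1)
  exact h.congr_deriv (by norm_num; ring)

theorem hasDerivAt_tau_alpha (v : Fin 4 → ℝ) (s α β : ℝ) :
    HasDerivAt (fun a : ℝ => tau v s a β)
      (-((2 * s + 1 / 3) * α * (v 1 - β * v 0))) α := by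
  unfold tau
  have h := ((hasDerivAt_pow 2 α).const_mul ((s + 1 / 6) * (v 1 - β * v 0))).const_sub
    (v 3 - β * v 2 + β ^ 2 / 2 * v 1 - β ^ 3 / 6 * v 0)
  exact h.congr_deriv (by norm_num; ring)

theorem hasDerivAt_rho_beta (v : Fin 4 → ℝ) (α β : ℝ) :
    HasDerivAt (fun b : ℝ => rho v α b) (-(v 1 - β * v 0)) β := by
  unfold rho
  have h := (((hasDerivAt_id' β).mul_const (v 1)).const_sub (v 2)).add
    ((((hasDerivAt_pow 2 β).sub_const (α ^ 2)).mul_const (v 0)).div_const 2)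
  exact h.congr_deriv (by norm_num; ring)

theorem hasDerivAt_tau_beta (v : Fin 4 → ℝ) (s α β : ℝ) :
    HasDerivAt (fun b : ℝ => tau v s α b)
      (-rho v α β + α ^ 2 * (s - 1 / 3) * v 0) β := by
  unfold tau
  have h := (((((hasDerivAt_id' β).mul_const (v 2)).const_sub (v 3)).add
    (((hasDerivAt_pow 2 β).div_const 2).mul_const (v 1))).sub
    (((hasDerivAt_pow 3 β).div_const 6).mul_const (v 0))).sub
    (((((hasDerivAt_id' β).mul_const (v 0)).const_sub (v 1)).const_mul (s + 1 / 6)).mul_const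
      (α ^ 2))
  exact h.congr_deriv (by norm_num [rho]; ring)

/-- A critical point of a numerical λ-wall lying off the associated numerical ν-wall
forces `s0 < 1/3`, `Δ₀₂ ≠ 0`, and the identity
`α0²(s0 − 1/3)Δ₀₂² = −(2s0 + 1/3)Δ₁₂²`. -/
theorem critical_point_off_nu_wall
    (u v : Fin 4 → ℝ) (s0 : ℝ) (hs0 : 0 < s0) (α0 β0 : ℝ) (hα0 : 0 < α0)
    (hf : fwall u v s0 α0 β0 = 0)
    (hfα : deriv (fun a : ℝ => fwall u v s0 a β0) α0 = 0)
    (hfβ : deriv (fun b : ℝ => fwall u v s0 α0 b) β0 = 0)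
    (h21 : Dlt u v α0 β0 2 1 ≠ 0) :
    s0 < 1 / 3 ∧ Dlt u v α0 β0 0 2 ≠ 0 ∧
      α0 ^ 2 * (s0 - 1 / 3) * (Dlt u v α0 β0 0 2) ^ 2 =
        -(2 * s0 + 1 / 3) * (Dlt u v α0 β0 1 2) ^ 2 := by
  have hα := (((hasDerivAt_tau_alpha u s0 α0 β0).mul (hasDerivAt_rho_alpha v α0 β0)).sub
    ((hasDerivAt_tau_alpha v s0 α0 β0).mul (hasDerivAt_rho_alpha u α0 β0))).deriv.symm.trans hfα
  have hβ := (((hasDerivAt_tau_beta u s0 α0 β0).mul (hasDerivAt_rho_beta v α0 β0)).sub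
    ((hasDerivAt_tau_beta v s0 α0 β0).mul (hasDerivAt_rho_beta u α0 β0))).deriv.symm.trans hfβ
  simp only [fwall] at hf
  have h02 : Dlt u v α0 β0 0 2 = u 0 * rho v α0 β0 - rho u α0 β0 * v 0 := rfl
  have h12 : Dlt u v α0 β0 1 2 =
      (u 1 - β0 * u 0) * rho v α0 β0 - rho u α0 β0 * (v 1 - β0 * v 0) := rfl
  have h12_ne : Dlt u v α0 β0 1 2 ≠ 0 := fun h => h21 (by
    simp only [Dlt] at h ⊢
    linarith)
  generalize rho u α0 β0 = ru at *
  generalize rho v α0 β0 = rv at *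
  generalize tau u s0 α0 β0 = tu at *
  generalize tau v s0 α0 β0 = tv at *
  have hα' : (2 * s0 + 1 / 3) * Dlt u v α0 β0 1 2 + (tu * v 0 - tv * u 0) = 0 := by
    refine mul_left_cancel₀ hα0.ne' ?_
    rw [h12]
    linear_combination -hα
  have hβ' : α0 ^ 2 * (s0 - 1 / 3) * Dlt u v α0 β0 0 2 =
      tu * (v 1 - β0 * v 0) - tv * (u 1 - β0 * u 0) := by
    rw [h02]
    linear_combination hβ
  have key : α0 ^ 2 * (s0 - 1 / 3) * (Dlt u v α0 β0 0 2) ^ 2 =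
      -(2 * s0 + 1 / 3) * (Dlt u v α0 β0 1 2) ^ 2 := by
    have plucker : (tu * v 0 - tv * u 0) * Dlt u v α0 β0 1 2 =
        (tu * (v 1 - β0 * v 0) - tv * (u 1 - β0 * u 0)) * Dlt u v α0 β0 0 2 := by
      rw [h02, h12]
      linear_combination (v 0 * (u 1 - β0 * u 0) - u 0 * (v 1 - β0 * v 0)) * hf
    linear_combination Dlt u v α0 β0 0 2 * hβ' + Dlt u v α0 β0 1 2 * hα' - plucker
  have hneg : α0 ^ 2 * (s0 - 1 / 3) * (Dlt u v α0 β0 0 2) ^ 2 < 0 := by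
    have : 0 < (2 * s0 + 1 / 3) * (Dlt u v α0 β0 1 2) ^ 2 := by positivity
    linarith
  refine ⟨?_, ?_, key⟩
  · by_contra! h
    have : 0 ≤ s0 - 1 / 3 := sub_nonneg.2 h
    exact hneg.not_ge (by positivity)
  · intro h
    simp [h] at hneg
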